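/- (Nonexistence of optimal embedded graphs) Let D₁ = (−1,0), D₂ = (1,0), D₃ = (n,0) in ℝ² and l = n+2. Then for all sufficiently large positive integers n, the problem (enem) with D = {D₁,D₂,D₃} has no solution: no connected metric graph Γ of total length l with vertex subset V ⊂ V(Γ) and embedding γ:Γ→ℝ² with γ(V) = D attains the infimum of E(Γ;V) over all such admissible triples. -/

import Mathlib

open MeasureTheory Set Filter
open scoped ENNReal

/-- A metric graph: a finite combinatorial graph on `N` vertices (an irreflexive symmetric
edge relation) together with a positive length assigned to each edge. -/
structure MetricGraph where
  N : ℕ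
  edge : Fin N → Fin N → Prop
  edge_symm : ∀ i j, edge i j → edge j i
  edge_irrefl : ∀ i, ¬ edge i i
  len : Fin N → Fin N → ℝ
  len_symm : ∀ i j, len i j = len j i
  len_pos : ∀ i j, edge i j → 0 < len i j

namespace MetricGraph

open scoped Classical in
/-- Total length of a metric graph: the sum of the lengths of its edges. -/
noncomputable def totalLength (G : MetricGraph) : ℝ :=
  ∑ i : Fin G.N, ∑ j : Fin G.N, if i < j ∧ G.edge i j then G.len i j else 0

open scoped Classical in
/-- The number of (undirected) edges. -/
noncomputable def edgeCount (G : MetricGraph) : ℕ :=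
  ∑ i : Fin G.N, ∑ j : Fin G.N, if i < j ∧ G.edge i j then 1 else 0

open scoped Classical in
/-- The degree of a vertex: the number of edges incident to it. -/
noncomputable def degree (G : MetricGraph) (i : Fin G.N) : ℕ :=
  ∑ j : Fin G.N, if G.edge i j then 1 else 0

/-- A metric graph is connected if it is nonempty and any two vertices are joined by a path. -/
def Connected (G : MetricGraph) : Prop :=
  0 < G.N ∧ ∀ i j : Fin G.N, Relation.ReflTransGen G.edge i j

/-- The graph obtained by removing the (undirected) edge `{a, b}`. -/
def removeEdge (G : MetricGraph) (a b : Fin G.N) : MetricGraph where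
  N := G.N
  edge i j := G.edge i j ∧ ¬((i = a ∧ j = b) ∨ (i = b ∧ j = a))
  edge_symm := fun i j h => ⟨G.edge_symm i j h.1, by tauto⟩
  edge_irrefl := fun i h => G.edge_irrefl i h.1
  len := G.len
  len_symm := G.len_symm
  len_pos := fun i j h => G.len_pos i j h.1

/-- A tree is a connected graph which becomes disconnected after the removal of any edge. -/
def IsTree (G : MetricGraph) : Prop :=
  G.Connected ∧ ∀ a b, G.edge a b → ¬ (G.removeEdge a b).Connected

end MetricGraph

/-- A function in `H¹(Γ)` on a metric graph `Γ`: a family of `H¹` functions on the edges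
(recorded together with their derivatives, via the fundamental theorem of calculus),
compatible with the orientation reversal `u ji x = u ij (l ij - x)` and continuous at
the vertices. -/
structure H1Fun (G : MetricGraph) where
  toFun : Fin G.N → Fin G.N → ℝ → ℝ
  deriv : Fin G.N → Fin G.N → ℝ → ℝ
  symm : ∀ i j, G.edge i j → ∀ x, toFun j i x = toFun i j (G.len i j - x)
  vertexCont : ∀ i j k, G.edge i j → G.edge i k → toFun i j 0 = toFun i k 0
  deriv_integrable : ∀ i j, G.edge i j →
    MeasureTheory.IntegrableOn (deriv i j) (Set.Icc 0 (G.len i j))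
  deriv_sq_integrable : ∀ i j, G.edge i j →
    MeasureTheory.IntegrableOn (fun t => (deriv i j t) ^ 2) (Set.Icc 0 (G.len i j))
  ftc : ∀ i j, G.edge i j → ∀ x ∈ Set.Icc (0 : ℝ) (G.len i j),
    toFun i j x = toFun i j 0 + ∫ t in (0 : ℝ)..x, deriv i j t

/-- `u` vanishes at every vertex of `W` (Dirichlet condition). -/
def H1Fun.ZeroOn {G : MetricGraph} (u : H1Fun G) (W : Set (Fin G.N)) : Prop :=
  ∀ i ∈ W, ∀ j, G.edge i j → u.toFun i j 0 = 0

open scoped Classical in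
/-- The functional `J(u) = ½∫_Γ |u'|² dx - ∫_Γ u dx`. -/
noncomputable def energyJ (G : MetricGraph) (u : H1Fun G) : ℝ :=
  ∑ i : Fin G.N, ∑ j : Fin G.N,
    if i < j ∧ G.edge i j then
      (1 / 2) * (∫ x in (0 : ℝ)..(G.len i j), (u.deriv i j x) ^ 2)
        - ∫ x in (0 : ℝ)..(G.len i j), u.toFun i j x
    else 0

/-- The Dirichlet energy `E(Γ; W)`. -/
noncomputable def dirEnergy (G : MetricGraph) (W : Set (Fin G.N)) : ℝ :=
  sInf {e : ℝ | ∃ u : H1Fun G, u.ZeroOn W ∧ energyJ G u = e}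

/-- An immersion of a metric graph into `ℝ^d`: a continuous map whose restriction to every
edge is an injective arc-length parametrized curve. -/
structure Immersion (G : MetricGraph) (d : ℕ) where
  toFun : Fin G.N → Fin G.N → ℝ → EuclideanSpace ℝ (Fin d)
  vpos : Fin G.N → EuclideanSpace ℝ (Fin d)
  start : ∀ i j, G.edge i j → toFun i j 0 = vpos i
  symm : ∀ i j, G.edge i j → ∀ x, toFun j i x = toFun i j (G.len i j - x)
  arclen : ∀ i j, G.edge i j → ∀ s t : ℝ, 0 ≤ s → s ≤ t → t ≤ G.len i j →
    eVariationOn (toFun i j) (Set.Icc s t) = ENNReal.ofReal (t - s)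
  inj : ∀ i j, G.edge i j → Set.InjOn (toFun i j) (Set.Icc 0 (G.len i j))

/-- An embedding is an injective immersion: the interiors of distinct edges are pairwise
disjoint and disjoint from all edges, and distinct vertices have distinct images. -/
def Immersion.IsEmbedding {G : MetricGraph} {d : ℕ} (γ : Immersion G d) : Prop :=
  (∀ i j i' j', G.edge i j → G.edge i' j' → ¬((i = i' ∧ j = j') ∨ (i = j' ∧ j = i')) →
    ∀ x ∈ Set.Ioo (0 : ℝ) (G.len i j), ∀ y ∈ Set.Icc (0 : ℝ) (G.len i' j'),
      γ.toFun i j x ≠ γ.toFun i' j' y) ∧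
  Function.Injective γ.vpos

/-- The Steiner length of a set `D ⊆ ℝ^d`: the infimum of the `H¹` lengths of the closed
connected sets containing `D`. -/
noncomputable def SteinerLen {d : ℕ} (D : Set (EuclideanSpace ℝ (Fin d))) : ℝ :=
  sInf {l : ℝ | 0 ≤ l ∧ ∃ C : Set (EuclideanSpace ℝ (Fin d)),
    IsClosed C ∧ IsConnected C ∧ D ⊆ C ∧ μH[1] C = ENNReal.ofReal l}

/-- The point `(a, b)` of the Euclidean plane. -/
noncomputable def pt (a b : ℝ) : EuclideanSpace ℝ (Fin 2) :=
  (WithLp.equiv 2 (Fin 2 → ℝ)).symm ![a, b]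

/-- Thomson-type lower bound for a single edge: testing against the affine flux `x ↦ s - x`. -/
theorem edge_energy_lower_bound {L : ℝ} (hL : 0 ≤ L) {f d : ℝ → ℝ}
    (hd : IntegrableOn d (Icc 0 L)) (hd2 : IntegrableOn (fun t => (d t) ^ 2) (Icc 0 L))
    (hf : ∀ x ∈ Icc (0 : ℝ) L, f x = f 0 + ∫ t in (0 : ℝ)..x, d t) (s : ℝ) :
    -s * f 0 - (L - s) * f L - (s ^ 3 + (L - s) ^ 3) / 6 ≤
      (1 / 2) * (∫ x in (0 : ℝ)..L, (d x) ^ 2) - ∫ x in (0 : ℝ)..L, f x := by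
  have hdi : IntervalIntegrable d volume 0 L :=
    (intervalIntegrable_iff_integrableOn_Icc_of_le hL).2 hd
  have hd2i : IntervalIntegrable (fun t => (d t) ^ 2) volume 0 L :=
    (intervalIntegrable_iff_integrableOn_Icc_of_le hL).2 hd2
  set F : ℝ → ℝ := fun x => ∫ t in (0 : ℝ)..x, d t with hF
  have hFac : AbsolutelyContinuousOnInterval F 0 L :=
    hdi.absolutelyContinuousOnInterval_intervalIntegral (c := 0) (by simp)
  have hgac : AbsolutelyContinuousOnInterval (fun x : ℝ => s - x) 0 L :=
    ContDiffOn.absolutelyContinuousOnInterval (by fun_prop)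
  have hparts := hFac.integral_mul_deriv_eq_deriv_mul hgac
  have hderivg : deriv (fun x : ℝ => s - x) = fun _ => (-1 : ℝ) := by
    funext x
    simp
  have hderivF : ∫ x in (0 : ℝ)..L, deriv F x * (s - x) = ∫ x in (0 : ℝ)..L, d x * (s - x) := by
    apply intervalIntegral.integral_congr_ae
    filter_upwards [hdi.ae_hasDerivAt_integral] with x hx hxm
    rw [(hx (uIoc_subset_uIcc hxm) 0 (by simp)).deriv]
  rw [hderivg, hderivF] at hparts
  have hFint : IntervalIntegrable F volume 0 L := hFac.continuousOn.intervalIntegrable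
  have hfint : ∫ x in (0 : ℝ)..L, f x = f 0 * L + ∫ x in (0 : ℝ)..L, F x := by
    have : ∫ x in (0 : ℝ)..L, f x = ∫ x in (0 : ℝ)..L, (f 0 + F x) := by
      apply intervalIntegral.integral_congr
      intro x hx
      rw [uIcc_of_le hL] at hx
      exact hf x hx
    rw [this, intervalIntegral.integral_add (by simp) hFint]
    simp [mul_comm]
  have hF0 : F 0 = 0 := by simp [hF]
  have hFL : f L = f 0 + F L := hf L ⟨hL, le_rfl⟩
  have hdsi : IntervalIntegrable (fun x => d x * (s - x)) volume 0 L :=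
    hdi.mul_continuousOn (by fun_prop)
  have hsq : ∫ x in (0 : ℝ)..L, (s - x) ^ 2 = (s ^ 3 + (L - s) ^ 3) / 3 := by
    have h := intervalIntegral.integral_comp_sub_left (a := 0) (b := L) (fun x : ℝ => x ^ 2) s
    rw [h, integral_pow]
    norm_num
    ring
  have hnn : 0 ≤ ∫ x in (0 : ℝ)..L, (d x - (s - x)) ^ 2 :=
    intervalIntegral.integral_nonneg hL fun x _ => sq_nonneg _
  have hexp : ∫ x in (0 : ℝ)..L, (d x - (s - x)) ^ 2 =
      (∫ x in (0 : ℝ)..L, (d x) ^ 2) - 2 * (∫ x in (0 : ℝ)..L, d x * (s - x))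
        + ∫ x in (0 : ℝ)..L, (s - x) ^ 2 := by
    rw [← intervalIntegral.integral_const_mul, ← intervalIntegral.integral_sub hd2i
      (hdsi.const_mul 2), ← intervalIntegral.integral_add (hd2i.sub (hdsi.const_mul 2))
      (Continuous.intervalIntegrable (by fun_prop) _ _)]
    apply intervalIntegral.integral_congr
    intro x _
    ring
  rw [hexp, hsq] at hnn
  simp only [mul_neg, mul_one, intervalIntegral.integral_neg, hF0] at hparts
  rw [hfint, hFL]
  nlinarith

section WeightedGraph

variable {α : Type*} {H : SimpleGraph α} {ℓ W : Sym2 α → ℝ} {U : α → ℝ}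

/-- Bound for a walk carrying point loads `m`, along which a nonnegative flux `β` enters at the
start and everything is drained at the end. -/
theorem walk_energy_through (hℓ : ∀ e ∈ H.edgeSet, 0 < ℓ e)
    (hE : ∀ i j, H.Adj i j → ∀ s : ℝ,
      -s * U i - (ℓ s(i, j) - s) * U j - (s ^ 3 + (ℓ s(i, j) - s) ^ 3) / 6 ≤ W s(i, j))
    {m : α → ℝ} (hm : ∀ v, 0 ≤ m v) {x y : α} (p : H.Walk x y) (β : ℝ) (hβ : 0 ≤ β) :
    0 ≤ (p.edges.map ℓ).sum ∧ 0 ≤ (p.support.tail.map m).sum ∧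
    β * U x - (β + (p.support.tail.map m).sum + (p.edges.map ℓ).sum) * U y
      - ((p.support.tail.map m).sum ^ 3
        + (β + (p.support.tail.map m).sum + (p.edges.map ℓ).sum) ^ 3
        - (β + (p.support.tail.map m).sum) ^ 3) / 6
      ≤ (p.edges.map W).sum - (p.support.tail.map fun v => m v * U v + m v ^ 3 / 6).sum := by
  induction p generalizing β with
  | nil => simp
  | @cons x z y h q ih =>
    have hL := hℓ s(x, z) h
    have hW := hE x z h (-β)
    have hmz := hm z
    have hβ' : 0 ≤ β + ℓ s(x, z) + m z := by positivity
    obtain ⟨h1, h2, h3⟩ := ih _ hβ'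
    have hsupp : q.support = z :: q.support.tail := q.cons_tail_support.symm
    simp only [SimpleGraph.Walk.edges_cons, SimpleGraph.Walk.support_cons, List.tail_cons,
      List.map_cons, List.sum_cons]
    rw [hsupp]
    simp only [List.map_cons, List.sum_cons]
    generalize (q.support.tail.map m).sum = τ at *
    generalize (q.edges.map ℓ).sum = len at *
    generalize (q.edges.map W).sum = w at *
    generalize (q.support.tail.map fun v => m v * U v + m v ^ 3 / 6).sum = ld at *
    generalize ℓ s(x, z) = L at *
    generalize W s(x, z) = w0 at *
    generalize m z = k at *
    refine ⟨by positivity, by positivity, ?_⟩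
    have key : 0 ≤ 3 * k * τ * (k + τ) + 3 * L * (k + τ) * (2 * β + k + τ + L) := by positivity
    have e : β + (k + τ) + (L + len) = β + L + k + τ + len := by ring
    rw [e]
    nlinarith

/-- Bound for a walk carrying point loads `m`, where a mass `β` is drained at the start and a
mass `μ` is drained at the end. -/
theorem walk_energy_split (hℓ : ∀ e ∈ H.edgeSet, 0 < ℓ e)
    (hE : ∀ i j, H.Adj i j → ∀ s : ℝ,
      -s * U i - (ℓ s(i, j) - s) * U j - (s ^ 3 + (ℓ s(i, j) - s) ^ 3) / 6 ≤ W s(i, j))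
    {m : α → ℝ} (hm : ∀ v, 0 ≤ m v) {x y : α} (p : H.Walk x y) (β μ : ℝ) (hβ : 0 ≤ β)
    (hμ : 0 ≤ μ) (h : β + μ = (p.edges.map ℓ).sum + (p.support.tail.map m).sum) :
    -β * U x - μ * U y - (β ^ 3 + μ ^ 3 + (p.support.tail.map m).sum ^ 3) / 6
      ≤ (p.edges.map W).sum - (p.support.tail.map fun v => m v * U v + m v ^ 3 / 6).sum := by
  induction p generalizing β with
  | nil =>
    simp only [SimpleGraph.Walk.edges_nil, List.map_nil, List.sum_nil,
      SimpleGraph.Walk.support_nil, List.tail_cons] at h ⊢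
    obtain rfl : β = 0 := by linarith
    obtain rfl : μ = 0 := by linarith
    simp
  | @cons x z y hxz q ih =>
    have hL := hℓ s(x, z) hxz
    have hmz := hm z
    have hW := hE x z hxz β
    have hthr := walk_energy_through hℓ hE hm q
    have hsupp : q.support = z :: q.support.tail := q.cons_tail_support.symm
    simp only [SimpleGraph.Walk.edges_cons, SimpleGraph.Walk.support_cons, List.tail_cons,
      List.map_cons, List.sum_cons] at h ⊢
    rw [hsupp] at h ⊢
    simp only [List.map_cons, List.sum_cons] at h ⊢
    obtain ⟨h1, h2, -⟩ := hthr 0 le_rfl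
    have ih' := ih (β - ℓ s(x, z) - m z)
    have hthr' := hthr (ℓ s(x, z) + m z - β)
    clear hthr ih
    generalize (q.support.tail.map m).sum = τ at *
    generalize (q.edges.map ℓ).sum = len at *
    generalize (q.edges.map W).sum = w at *
    generalize (q.support.tail.map fun v => m v * U v + m v ^ 3 / 6).sum = ld at *
    generalize ℓ s(x, z) = L at *
    generalize W s(x, z) = w0 at *
    generalize m z = k at *
    have hcube : k ^ 3 + τ ^ 3 ≤ (k + τ) ^ 3 := by
      have : 0 ≤ 3 * k * τ * (k + τ) := by positivity
      nlinarith
    rcases le_total (L + k) β with hc | hc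
    · have h3 := ih' (by linarith) (by linarith)
      have : (β - L - k) ^ 3 ≤ (β - L) ^ 3 :=
        pow_le_pow_left₀ (by linarith) (by linarith) 3
      have e : (L - β) ^ 3 = -(β - L) ^ 3 := by ring
      rw [e] at hW
      nlinarith
    · obtain ⟨-, -, h3⟩ := hthr' (by linarith)
      have e : L + k - β + τ + len = μ := by linarith
      rw [e] at h3
      have : (L - β) ^ 3 ≤ (L + k - β + τ) ^ 3 := by
        have : Odd 3 := by decide
        exact this.strictMono_pow.monotone (by linarith)
      nlinarith

/-- All edges outside a set `F` of edges spanned by `K` can be replaced by point loads on `K`. -/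
theorem exists_loads [Fintype α] [DecidableEq α] [DecidableRel H.Adj]
    (hℓ : ∀ e ∈ H.edgeSet, 0 < ℓ e)
    (hE : ∀ i j, H.Adj i j → ∀ s : ℝ,
      -s * U i - (ℓ s(i, j) - s) * U j - (s ^ 3 + (ℓ s(i, j) - s) ^ 3) / 6 ≤ W s(i, j))
    (hH : H.Connected) (K : Finset α) (hK : K.Nonempty) (F : Finset (Sym2 α))
    (hF : F ⊆ H.edgeFinset) (hFK : ∀ e ∈ F, ∀ v ∈ e, v ∈ K) :
    ∃ m : α → ℝ, (∀ v, 0 ≤ m v) ∧ ∑ v ∈ K, m v = ∑ e ∈ H.edgeFinset \ F, ℓ e ∧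
      -∑ v ∈ K, (m v * U v + m v ^ 3 / 6) ≤ ∑ e ∈ H.edgeFinset \ F, W e := by
  have exists_put_load : ∀ (K : Finset α) (m : α → ℝ), (∀ v, 0 ≤ m v) → ∀ k ∈ K, ∀ c : ℝ, 0 ≤ c →
      ∃ m' : α → ℝ, (∀ v, 0 ≤ m' v) ∧ ∑ v ∈ K, m' v = ∑ v ∈ K, m v + c ∧
        ∑ v ∈ K, (m v * U v + m v ^ 3 / 6) + (c * U k + c ^ 3 / 6) ≤
          ∑ v ∈ K, (m' v * U v + m' v ^ 3 / 6) := by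
    intro K m hm k hk c hc
    refine ⟨Function.update m k (m k + c), ?_, ?_, ?_⟩
    · intro v
      have := hm v
      have := hm k
      by_cases hv : v = k
      · subst hv
        simpa using by positivity
      · simpa [hv] using hm v
    · rw [← Finset.add_sum_erase _ _ hk, ← Finset.add_sum_erase _ m hk]
      rw [Finset.sum_congr rfl (g := m) fun v hv => by simp [Finset.ne_of_mem_erase hv]]
      simp
      ring
    · rw [← Finset.add_sum_erase _ _ hk,
        ← Finset.add_sum_erase K (fun v => Function.update m k (m k + c) v * U v + _) hk]
      rw [Finset.sum_congr (s₁ := K.erase k) rfl (g := fun v => m v * U v + m v ^ 3 / 6)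
        (f := fun v => Function.update m k (m k + c) v * U v + _)
        fun v hv => by simp [Finset.ne_of_mem_erase hv]]
      simp only [Function.update_self]
      have := hm k
      have : 0 ≤ 3 * m k * c * (m k + c) := by positivity
      nlinarith
  induction hn : (Finset.univ \ K).card generalizing K F with
  | zero =>
    have hKu : K = Finset.univ := by
      rw [Finset.card_eq_zero, Finset.sdiff_eq_empty_iff_subset] at hn
      exact Finset.eq_univ_of_forall fun v => hn (Finset.mem_univ v)
    subst hKu
    have : ∀ R : Finset (Sym2 α), R ⊆ H.edgeFinset → ∃ m : α → ℝ, (∀ v, 0 ≤ m v) ∧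
        ∑ v, m v = ∑ e ∈ R, ℓ e ∧ -∑ v, (m v * U v + m v ^ 3 / 6) ≤ ∑ e ∈ R, W e := by
      intro R
      induction R using Finset.induction_on with
      | empty => exact fun _ => ⟨0, by simp⟩
      | insert e R he ih =>
        intro hR
        obtain ⟨m, hm, hs, hle⟩ := ih fun a ha => hR (Finset.mem_insert_of_mem ha)
        have hmem : e ∈ H.edgeSet := by
          have := hR (Finset.mem_insert_self e R)
          simpa using this
        have hpos := hℓ e hmem
        induction e using Sym2.ind with
        | _ i j =>
          obtain ⟨m', hm', hs', hle'⟩ :=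
            exists_put_load Finset.univ m hm i (Finset.mem_univ i) _ hpos.le
          have hW := hE i j hmem (ℓ s(i, j))
          refine ⟨m', hm', ?_, ?_⟩
          · rw [Finset.sum_insert he, hs', hs]
            ring
          · rw [Finset.sum_insert he]
            simp only [sub_self] at hW
            linarith
    exact this _ Finset.sdiff_subset
  | succ n ih =>
    obtain ⟨k, hk, x, hx, hkx⟩ : ∃ k ∈ K, ∃ x ∉ K, H.Adj k x := by
      have : (Finset.univ \ K).Nonempty := by
        rw [← Finset.card_pos]
        omega
      obtain ⟨z, hz⟩ := this
      obtain ⟨k0, hk0⟩ := hK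
      obtain ⟨p⟩ := hH.preconnected k0 z
      obtain ⟨d, -, hd1, hd2⟩ := p.exists_boundary_dart (K : Set α) hk0 (by simpa using hz)
      exact ⟨d.fst, hd1, d.snd, hd2, d.adj⟩
    have hxF : s(k, x) ∉ F := fun hmem => hx (hFK _ hmem x (by simp))
    have hkxE : s(k, x) ∈ H.edgeFinset := by simpa using hkx
    obtain ⟨m, hm, hs, hle⟩ := ih (insert x K) (Finset.insert_nonempty x K)
      (insert s(k, x) F) (Finset.insert_subset hkxE hF)
      (by
        intro e he v hv
        rcases Finset.mem_insert.1 he with rfl | he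
        · rcases Sym2.mem_iff.1 hv with rfl | rfl <;> simp [hk]
        · exact Finset.mem_insert_of_mem (hFK e he v hv))
      (by
        have : Finset.univ \ insert x K = (Finset.univ \ K).erase x := by
          ext; simp
        rw [this, Finset.card_erase_of_mem (by simpa using hx)]
        omega)
    have hpos := hℓ s(k, x) hkx
    have hmx := hm x
    obtain ⟨m', hm', hs', hle'⟩ := exists_put_load K m hm k hk (ℓ s(k, x) + m x) (by positivity)
    have hsplit : ∀ f : Sym2 α → ℝ, ∑ e ∈ H.edgeFinset \ F, f e =
        f s(k, x) + ∑ e ∈ H.edgeFinset \ insert s(k, x) F, f e := by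
      intro f
      rw [← Finset.add_sum_erase (H.edgeFinset \ F) f (a := s(k, x))
        (Finset.mem_sdiff.2 ⟨hkxE, hxF⟩)]
      congr 2
      ext e
      simp only [Finset.mem_erase, Finset.mem_sdiff, Finset.mem_insert]
      tauto
    refine ⟨m', hm', ?_, ?_⟩
    · rw [hsplit, ← hs, hs', Finset.sum_insert hx]
      ring
    · rw [hsplit]
      rw [Finset.sum_insert hx] at hle
      have hW := hE k x hkx (ℓ s(k, x) + m x)
      nlinarith

end WeightedGraph

section Tripod

variable {α : Type*} {H : SimpleGraph α}

theorem SimpleGraph.Walk.exists_isPath_first_mem {x y : α} (q : H.Walk x y) (S : Set α)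
    (hy : y ∈ S) :
    ∃ z ∈ S, ∃ q' : H.Walk x z, q'.IsPath ∧ ∀ v ∈ q'.support, v ∈ S → v = z := by
  classical
  suffices ∃ z ∈ S, ∃ q' : H.Walk x z, ∀ v ∈ q'.support, v ∈ S → v = z by
    obtain ⟨z, hz, q', h⟩ := this
    exact ⟨z, hz, q'.bypass, q'.bypass_isPath,
      fun v hv => h v (q'.support_bypass_subset_support hv)⟩
  induction q with
  | nil => exact ⟨_, hy, .nil, by simp⟩
  | @cons x w y h q ih =>
    by_cases hx : x ∈ S
    · exact ⟨x, hx, .nil, by simp⟩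
    · obtain ⟨z, hz, q', hq'⟩ := ih hy
      refine ⟨z, hz, .cons h q', ?_⟩
      intro v hv hvS
      rw [SimpleGraph.Walk.support_cons, List.mem_cons] at hv
      rcases hv with rfl | hv
      · exact absurd hvS hx
      · exact hq' v hv hvS

/-- In a connected graph any three vertices span a (possibly degenerate) tripod. -/
theorem SimpleGraph.Connected.exists_tripod (hH : H.Connected) (v₁ v₂ v₃ : α) :
    ∃ (J : α) (pa : H.Walk J v₁) (pb : H.Walk J v₃) (pc : H.Walk J v₂),
      pa.IsPath ∧ pb.IsPath ∧ pc.IsPath ∧ pa.support.tail.Disjoint pb.support.tail ∧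
      pa.support.tail.Disjoint pc.support.tail ∧ pb.support.tail.Disjoint pc.support.tail := by
  classical
  obtain ⟨P, hP⟩ := (hH.preconnected v₁ v₃).exists_isPath
  obtain ⟨Q⟩ := hH.preconnected v₂ v₃
  obtain ⟨J, hJ, q, hq, hqS⟩ := Q.exists_isPath_first_mem {v | v ∈ P.support} P.end_mem_support
  have hJP : J ∈ P.support := hJ
  have hsplit : P.support = (P.takeUntil J hJP).support ++ (P.dropUntil J hJP).support.tail := by
    rw [← SimpleGraph.Walk.support_append, SimpleGraph.Walk.take_spec]
  have hnd := hP.support_nodup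
  rw [hsplit, List.nodup_append'] at hnd
  have hta : ∀ v ∈ (P.takeUntil J hJP).reverse.support.tail, v ∈ (P.takeUntil J hJP).support := by
    intro v hv
    simpa using List.mem_of_mem_tail hv
  have hqt : ∀ v ∈ q.reverse.support.tail, v ∉ P.support := by
    intro v hv hvP
    have h1 : v ∈ q.support := by simpa using List.mem_of_mem_tail hv
    obtain rfl := hqS v h1 hvP
    have h2 := hq.reverse.support_nodup
    rw [← SimpleGraph.Walk.cons_tail_support] at h2
    exact (List.nodup_cons.1 h2).1 hv
  refine ⟨J, (P.takeUntil J hJP).reverse, P.dropUntil J hJP, q.reverse,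
    (hP.takeUntil hJP).reverse, hP.dropUntil hJP, hq.reverse, ?_, ?_, ?_⟩
  · intro v hv1 hv2
    exact hnd.2.2 (hta v hv1) hv2
  · intro v hv1 hv2
    exact hqt v hv2 (P.support_takeUntil_subset_support hJP (hta v hv1))
  · intro v hv1 hv2
    exact hqt v hv2 (P.support_dropUntil_subset_support hJP (List.mem_of_mem_tail hv1))

theorem SimpleGraph.Walk.disjoint_edges_of_disjoint_tail {J x y : α} (p : H.Walk J x)
    (q : H.Walk J y) (h : p.support.tail.Disjoint q.support.tail) :
    p.edges.Disjoint q.edges := by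
  have key : ∀ v, v ∈ p.support → v ∈ q.support → v = J := by
    intro v hp hq
    rw [← SimpleGraph.Walk.cons_tail_support, List.mem_cons] at hp hq
    rcases hp with hp | hp
    · exact hp
    · rcases hq with hq | hq
      · exact hq
      · exact (h hp hq).elim
  intro e hp hq
  induction e using Sym2.ind with
  | _ u v =>
    have h1 := key u (p.fst_mem_support_of_mem_edges hp) (q.fst_mem_support_of_mem_edges hq)
    have h2 := key v (p.snd_mem_support_of_mem_edges hp) (q.snd_mem_support_of_mem_edges hq)
    exact (p.adj_of_mem_edges hp).ne (h1.trans h2.symm)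

theorem tripod_energy_lower_bound [Fintype α] [DecidableEq α] [DecidableRel H.Adj]
    {ℓ W : Sym2 α → ℝ} {U : α → ℝ} (hℓ : ∀ e ∈ H.edgeSet, 0 < ℓ e)
    (hE : ∀ i j, H.Adj i j → ∀ s : ℝ,
      -s * U i - (ℓ s(i, j) - s) * U j - (s ^ 3 + (ℓ s(i, j) - s) ^ 3) / 6 ≤ W s(i, j))
    (hH : H.Connected) {J v₁ v₂ v₃ : α} (h₁ : U v₁ = 0) (h₂ : U v₂ = 0) (h₃ : U v₃ = 0)
    {pa : H.Walk J v₁} {pb : H.Walk J v₃} {pc : H.Walk J v₂}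
    (ha : pa.IsPath) (hb : pb.IsPath) (hc : pc.IsPath)
    (hab : pa.support.tail.Disjoint pb.support.tail)
    (hac : pa.support.tail.Disjoint pc.support.tail)
    (hbc : pb.support.tail.Disjoint pc.support.tail)
    {a b c t : ℝ} (hla : a = (pa.edges.map ℓ).sum) (hlb : b = (pb.edges.map ℓ).sum)
    (hlc : c = (pc.edges.map ℓ).sum) (ht : ∑ e ∈ H.edgeFinset, ℓ e = a + b + c + t) :
    0 ≤ a ∧ 0 ≤ b ∧ 0 ≤ c ∧ 0 ≤ t ∧ ∀ A C : ℝ, t ≤ A → t ≤ C → A + C ≤ b + t →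
      -((A + C) ^ 3 + (b + t - A - C) ^ 3 + ((A + a) ^ 3 - A ^ 3) + ((C + c) ^ 3 - C ^ 3)
        + t ^ 3) / 6 ≤ ∑ e ∈ H.edgeFinset, W e := by
  set E := pa.edges ++ (pb.edges ++ pc.edges) with hEdef
  set T := pa.support.tail ++ (pb.support.tail ++ pc.support.tail) with hTdef
  have hEnd : E.Nodup := by
    have h1 := pa.disjoint_edges_of_disjoint_tail pb hab
    have h2 := pa.disjoint_edges_of_disjoint_tail pc hac
    have h3 := pb.disjoint_edges_of_disjoint_tail pc hbc
    rw [hEdef, List.nodup_append', List.nodup_append', List.disjoint_append_right]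
    exact ⟨ha.edges_nodup, ⟨hb.edges_nodup, hc.edges_nodup, h3⟩, h1, h2⟩
  have hsplit : ∀ {y : α} {p : H.Walk J y}, p.IsPath →
      J ∉ p.support.tail ∧ p.support.tail.Nodup := by
    intro y p hp
    have h := hp.support_nodup
    rw [← SimpleGraph.Walk.cons_tail_support] at h
    exact List.nodup_cons.1 h
  have hTnd : (J :: T).Nodup := by
    rw [List.nodup_cons, hTdef, List.nodup_append', List.nodup_append', List.disjoint_append_right]
    refine ⟨?_, (hsplit ha).2, ⟨(hsplit hb).2, (hsplit hc).2, hbc⟩, hab, hac⟩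
    simp [(hsplit ha).1, (hsplit hb).1, (hsplit hc).1]
  have hEsub : E.toFinset ⊆ H.edgeFinset := by
    intro e he
    simp only [hEdef, List.mem_toFinset, List.mem_append] at he
    rw [SimpleGraph.mem_edgeFinset]
    rcases he with he | he | he
    · exact pa.edges_subset_edgeSet he
    · exact pb.edges_subset_edgeSet he
    · exact pc.edges_subset_edgeSet he
  have hEK : ∀ e ∈ E.toFinset, ∀ v ∈ e, v ∈ (J :: T).toFinset := by
    intro e he v hv
    have aux : ∀ {y : α} (p : H.Walk J y), e ∈ p.edges → v = J ∨ v ∈ p.support.tail := by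
      intro y p hp
      have := p.mem_support_of_mem_edges hp hv
      rwa [← SimpleGraph.Walk.cons_tail_support, List.mem_cons] at this
    simp only [hEdef, List.mem_toFinset, List.mem_append] at he
    simp only [hTdef, List.mem_toFinset, List.mem_cons, List.mem_append]
    rcases he with he | he | he
    · rcases aux pa he with h | h <;> tauto
    · rcases aux pb he with h | h <;> tauto
    · rcases aux pc he with h | h <;> tauto
  obtain ⟨m, hm, hs, hle⟩ := exists_loads hℓ hE hH (J :: T).toFinset ⟨J, by simp⟩ E.toFinset
    hEsub hEK
  have hsumE : ∀ f : Sym2 α → ℝ, ∑ e ∈ H.edgeFinset, f e = ∑ e ∈ H.edgeFinset \ E.toFinset, f e +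
      ((pa.edges.map f).sum + ((pb.edges.map f).sum + (pc.edges.map f).sum)) := by
    intro f
    rw [← Finset.sum_sdiff hEsub, List.sum_toFinset f hEnd, hEdef]
    simp
  have hsumT : ∀ f : α → ℝ, ∑ v ∈ (J :: T).toFinset, f v = f J + ((pa.support.tail.map f).sum +
      ((pb.support.tail.map f).sum + (pc.support.tail.map f).sum)) := by
    intro f
    rw [List.sum_toFinset f hTnd, hTdef]
    simp
  rw [hsumT] at hs hle
  have hWa := walk_energy_through hℓ hE hm pa
  have hWc := walk_energy_through hℓ hE hm pc
  have hWb := walk_energy_split hℓ hE hm pb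
  obtain ⟨hb0, hτb, -⟩ := walk_energy_through hℓ hE hm pb 0 le_rfl
  obtain ⟨ha0, hτa, -⟩ := hWa 0 le_rfl
  obtain ⟨hc0, hτc, -⟩ := hWc 0 le_rfl
  have hmJ := hm J
  rw [h₁] at hWa
  rw [h₂] at hWc
  rw [h₃] at hWb
  rw [hsumE] at ht
  rw [← hla] at hWa ha0 ht
  rw [← hlb] at hWb hb0 ht
  rw [← hlc] at hWc hc0 ht
  have htm : t = m J + ((pa.support.tail.map m).sum + ((pb.support.tail.map m).sum +
      (pc.support.tail.map m).sum)) := by linarith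
  refine ⟨ha0, hb0, hc0, by rw [htm]; positivity, ?_⟩
  intro A C hA hC hAC
  rw [hsumE]
  generalize (pa.support.tail.map m).sum = τa at *
  generalize (pb.support.tail.map m).sum = τb at *
  generalize (pc.support.tail.map m).sum = τc at *
  obtain ⟨-, -, ha1⟩ := hWa (A - τa) (by linarith)
  obtain ⟨-, -, hc1⟩ := hWc (C - τc) (by linarith)
  have hb1 := hWb (A + C - τa - τc - m J) (b + t - A - C) (by linarith) (by linarith) (by linarith)
  have hpow : (A + C - τa - τc - m J) ^ 3 ≤ (A + C) ^ 3 :=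
    pow_le_pow_left₀ (by linarith) (by linarith) 3
  have hcube : m J ^ 3 + τa ^ 3 + τb ^ 3 + τc ^ 3 ≤ t ^ 3 := by
    have aux : ∀ x y : ℝ, 0 ≤ x → 0 ≤ y → x ^ 3 + y ^ 3 ≤ (x + y) ^ 3 := by
      intro x y hx hy
      have : 0 ≤ 3 * x * y * (x + y) := by positivity
      nlinarith
    have h1 := aux τb τc hτb hτc
    have h2 := aux τa (τb + τc) hτa (by positivity)
    have h3 := aux (m J) (τa + (τb + τc)) hmJ (by positivity)
    rw [htm]
    linarith
  have ea : A - τa + τa = A := by ring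
  have ec : C - τc + τc = C := by ring
  rw [ea] at ha1
  rw [ec] at hc1
  linarith

end Tripod

section GraphModel

/-- The underlying simple graph of a metric graph. -/
def MetricGraph.toSimpleGraph (G : MetricGraph) : SimpleGraph (Fin G.N) where
  Adj := G.edge
  symm := ⟨G.edge_symm⟩
  loopless := ⟨G.edge_irrefl⟩

/-- The length of an unordered pair of vertices. -/
def MetricGraph.edgeLen (G : MetricGraph) : Sym2 (Fin G.N) → ℝ :=
  Sym2.lift ⟨G.len, G.len_symm⟩

theorem MetricGraph.edgeLen_mk (G : MetricGraph) (i j : Fin G.N) :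
    G.edgeLen s(i, j) = G.len i j := rfl

theorem MetricGraph.edgeLen_pos (G : MetricGraph) :
    ∀ e ∈ G.toSimpleGraph.edgeSet, 0 < G.edgeLen e := by
  intro e
  induction e using Sym2.ind with
  | _ i j => exact fun h => G.len_pos i j h

theorem MetricGraph.Connected.toSimpleGraph {G : MetricGraph} (h : G.Connected) :
    G.toSimpleGraph.Connected := by
  have : Nonempty (Fin G.N) := ⟨⟨0, h.1⟩⟩
  exact ⟨fun i j => (SimpleGraph.reachable_iff_reflTransGen i j).2 (h.2 i j)⟩

open scoped Classical in
theorem MetricGraph.sum_edges (G : MetricGraph) (f : Fin G.N → Fin G.N → ℝ)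
    (F : Sym2 (Fin G.N) → ℝ) (hF : ∀ i j, i < j → F s(i, j) = f i j) :
    (∑ i : Fin G.N, ∑ j : Fin G.N, if i < j ∧ G.edge i j then f i j else 0) =
      ∑ e ∈ G.toSimpleGraph.edgeFinset, F e := by
  rw [← Finset.sum_product', ← Finset.sum_filter]
  refine Finset.sum_bij (fun p _ => s(p.1, p.2)) ?_ ?_ ?_ ?_
  · intro p hp
    simp only [Finset.mem_filter] at hp
    rw [SimpleGraph.mem_edgeFinset]
    exact hp.2.2
  · intro p hp q hq h
    simp only [Finset.mem_filter] at hp hq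
    rcases Sym2.eq_iff.1 h with h | h
    · exact Prod.ext h.1 h.2
    · have := hp.2.1
      rw [h.1, h.2] at this
      exact absurd this hq.2.1.not_gt
  · intro e he
    rw [SimpleGraph.mem_edgeFinset] at he
    induction e using Sym2.ind with
    | _ i j =>
      have hij : G.edge i j := he
      rcases lt_trichotomy i j with h | h | h
      · exact ⟨(i, j), by simp [h, hij], rfl⟩
      · exact absurd hij (h ▸ G.edge_irrefl i)
      · exact ⟨(j, i), by simp [h, G.edge_symm _ _ hij], Sym2.eq_swap⟩
  · intro p hp
    simp only [Finset.mem_filter] at hp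
    exact (hF _ _ hp.2.1).symm

open scoped Classical in
theorem MetricGraph.totalLength_eq (G : MetricGraph) :
    G.totalLength = ∑ e ∈ G.toSimpleGraph.edgeFinset, G.edgeLen e :=
  G.sum_edges _ _ fun _ _ _ => rfl

open scoped Classical in
/-- The energy of an `H¹` function can be bounded below edge by edge in terms of
the values at the vertices. -/
theorem energyJ_eq_sum_edges {G : MetricGraph} (u : H1Fun G) {V : Set (Fin G.N)}
    (hu : u.ZeroOn V) :
    ∃ (W : Sym2 (Fin G.N) → ℝ) (U : Fin G.N → ℝ), (∀ i ∈ V, U i = 0) ∧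
      energyJ G u = ∑ e ∈ G.toSimpleGraph.edgeFinset, W e ∧
      ∀ i j, G.toSimpleGraph.Adj i j → ∀ s : ℝ,
        -s * U i - (G.edgeLen s(i, j) - s) * U j - (s ^ 3 + (G.edgeLen s(i, j) - s) ^ 3) / 6
          ≤ W s(i, j) := by
  set e : Fin G.N → Fin G.N → ℝ := fun i j =>
    (1 / 2) * (∫ x in (0 : ℝ)..(G.len i j), (u.deriv i j x) ^ 2)
        - ∫ x in (0 : ℝ)..(G.len i j), u.toFun i j x with he
  set U : Fin G.N → ℝ := fun i => if h : ∃ j, G.edge i j then u.toFun i h.choose 0 else 0 with hU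
  have hUi : ∀ i j, G.edge i j → u.toFun i j 0 = U i := by
    intro i j hij
    have h : ∃ j, G.edge i j := ⟨j, hij⟩
    simp only [hU, dif_pos h]
    exact u.vertexCont i j _ hij h.choose_spec
  have hUj : ∀ i j, G.edge i j → u.toFun i j (G.len i j) = U j := by
    intro i j hij
    rw [← hUi j i (G.edge_symm i j hij), u.symm i j hij 0, sub_zero]
  have hbound : ∀ i j, G.edge i j → ∀ s : ℝ,
      -s * U i - (G.len i j - s) * U j - (s ^ 3 + (G.len i j - s) ^ 3) / 6 ≤ e i j := by
    intro i j hij s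
    have h := edge_energy_lower_bound (G.len_pos i j hij).le (u.deriv_integrable i j hij)
      (u.deriv_sq_integrable i j hij) (u.ftc i j hij) s
    rwa [hUi i j hij, hUj i j hij] at h
  refine ⟨Sym2.lift ⟨fun i j => if i < j then e i j else e j i, ?_⟩, U, ?_, ?_, ?_⟩
  · intro i j
    rcases lt_trichotomy i j with h | h | h
    · simp [h, h.not_gt]
    · simp [h]
    · simp [h, h.not_gt]
  · intro i hi
    by_cases h : ∃ j, G.edge i j
    · rw [← hUi i _ h.choose_spec]
      exact hu i hi _ h.choose_spec
    · simp [hU, h]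
  · refine G.sum_edges _ _ fun i j hij => ?_
    simp [hij, he]
  · intro i j hij s
    rw [Sym2.lift_mk, G.edgeLen_mk]
    by_cases h : i < j
    · simpa only [h, if_true] using hbound i j hij s
    · simp only [h, if_false]
      have := hbound j i (G.edge_symm i j hij) (G.len i j - s)
      rw [G.len_symm j i] at this
      linarith

end GraphModel

section Geometry

variable {G : MetricGraph} {d : ℕ} (γ : Immersion G d)

theorem Immersion.toFun_len {i j : Fin G.N} (h : G.edge i j) :
    γ.toFun i j (G.len i j) = γ.vpos j := by
  rw [← γ.start j i (G.edge_symm i j h), γ.symm i j h 0, sub_zero]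

theorem Immersion.dist_toFun_le {i j : Fin G.N} (h : G.edge i j) {s t : ℝ} (hs : 0 ≤ s)
    (hst : s ≤ t) (ht : t ≤ G.len i j) : dist (γ.toFun i j s) (γ.toFun i j t) ≤ t - s := by
  have h1 := eVariationOn.edist_le (γ.toFun i j) (left_mem_Icc.2 hst) (right_mem_Icc.2 hst)
  rw [γ.arclen i j h s t hs hst ht, edist_dist] at h1
  exact (ENNReal.ofReal_le_ofReal_iff (by linarith)).1 h1

theorem Immersion.continuousOn_toFun {i j : Fin G.N} (h : G.edge i j) :
    ContinuousOn (γ.toFun i j) (Icc 0 (G.len i j)) := by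
  have : LipschitzOnWith 1 (γ.toFun i j) (Icc 0 (G.len i j)) := by
    refine LipschitzOnWith.of_dist_le_mul fun s hs t ht => ?_
    rw [NNReal.coe_one, one_mul, Real.dist_eq]
    rcases le_total s t with hst | hst
    · rw [abs_sub_comm, abs_of_nonneg (by linarith)]
      exact γ.dist_toFun_le h hs.1 hst ht.2
    · rw [dist_comm, abs_of_nonneg (by linarith)]
      exact γ.dist_toFun_le h ht.1 hst hs.2
  exact this.continuousOn

theorem Immersion.dist_vpos_le {x y : Fin G.N} (p : G.toSimpleGraph.Walk x y) :
    dist (γ.vpos x) (γ.vpos y) ≤ (p.edges.map G.edgeLen).sum := by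
  induction p with
  | nil => simp
  | @cons x z y h q ih =>
    have hxz : G.edge x z := h
    have h1 := γ.dist_toFun_le hxz le_rfl (G.len_pos x z hxz).le le_rfl
    rw [γ.start x z hxz, γ.toFun_len hxz, sub_zero] at h1
    simp only [SimpleGraph.Walk.edges_cons, List.map_cons, List.sum_cons, G.edgeLen_mk]
    exact (dist_triangle _ (γ.vpos z) _).trans (add_le_add h1 ih)

/-- A walk avoiding `v` crosses every coordinate hyperplane it meets at a point other than `v`. -/
theorem Immersion.IsEmbedding.exists_crossing {γ : Immersion G d} (hγ : γ.IsEmbedding)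
    (hG : G.toSimpleGraph.Connected) (k : Fin d) (c : ℝ) {v x y : Fin G.N}
    (p : G.toSimpleGraph.Walk x y)
    (hv : v ∉ p.support) (hx : γ.vpos x k ≤ c) (hy : c ≤ γ.vpos y k) :
    ∃ q : EuclideanSpace ℝ (Fin d), q k = c ∧ q ≠ γ.vpos v ∧
      dist (γ.vpos x) q + dist q (γ.vpos y) ≤ (p.edges.map G.edgeLen).sum := by
  induction p with
  | nil =>
    refine ⟨_, le_antisymm hx hy, fun h => ?_, by simp⟩
    have := hγ.2 h
    simp [this] at hv
  | @cons x z y h r ih =>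
    have hxz : G.edge x z := h
    rw [SimpleGraph.Walk.support_cons, List.mem_cons, not_or] at hv
    simp only [SimpleGraph.Walk.edges_cons, List.map_cons, List.sum_cons, G.edgeLen_mk]
    have hlen := (G.len_pos x z hxz).le
    by_cases hz : γ.vpos z k ≤ c
    · obtain ⟨q, hq, hqv, hqd⟩ := ih hv.2 hz hy
      refine ⟨q, hq, hqv, ?_⟩
      have h1 := γ.dist_toFun_le hxz le_rfl hlen le_rfl
      rw [γ.start x z hxz, γ.toFun_len hxz, sub_zero] at h1
      have h2 := dist_triangle (γ.vpos x) (γ.vpos z) q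
      linarith
    · have hcont : ContinuousOn (fun t => γ.toFun x z t k) (Icc 0 (G.len x z)) :=
        (PiLp.continuous_apply 2 _ k).comp_continuousOn (γ.continuousOn_toFun hxz)
      have hmem : c ∈ Icc (γ.toFun x z 0 k) (γ.toFun x z (G.len x z) k) := by
        rw [γ.start x z hxz, γ.toFun_len hxz]
        exact ⟨hx, (not_le.1 hz).le⟩
      obtain ⟨t, ht, htc⟩ := intermediate_value_Icc hlen hcont hmem
      refine ⟨γ.toFun x z t, htc, ?_, ?_⟩
      · intro heq
        have hzv : v ≠ z := fun h => hv.2 (h ▸ r.start_mem_support)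
        rcases ht.1.eq_or_lt with h0 | h0
        · rw [← h0, γ.start x z hxz] at heq
          exact hv.1 (hγ.2 heq).symm
        rcases ht.2.eq_or_lt with hl | hl
        · rw [hl, γ.toFun_len hxz] at heq
          exact hzv (hγ.2 heq).symm
        obtain ⟨w, hw⟩ : ∃ w, G.edge v w := by
          have : Nontrivial (Fin G.N) := ⟨v, z, hzv⟩
          exact hG.preconnected.exists_adj_of_nontrivial v
        refine hγ.1 x z v w hxz hw ?_ t ⟨h0, hl⟩ 0 ⟨le_rfl, (G.len_pos v w hw).le⟩ ?_
        · rintro (h | h)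
          · exact hv.1 h.1.symm
          · exact hzv h.2.symm
        · rw [heq, γ.start v w hw]
      · have h1 := γ.dist_toFun_le hxz le_rfl ht.1 ht.2
        have h2 := γ.dist_toFun_le hxz ht.1 ht.2 le_rfl
        rw [γ.start x z hxz] at h1
        rw [γ.toFun_len hxz] at h2
        have h3 := γ.dist_vpos_le r
        have h4 := dist_triangle (γ.toFun x z t) (γ.vpos z) (γ.vpos y)
        linarith

end Geometry

section TorsionInterp

/-- The function on a metric graph with prescribed vertex values `U` which solves `-u'' = 1`
inside each edge. -/
noncomputable def H1Fun.torsionInterp (G : MetricGraph) (U : Fin G.N → ℝ) : H1Fun G where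
  toFun i j t := U i + (U j - U i) * (t / G.len i j) + t * (G.len i j - t) / 2
  deriv i j t := (U j - U i) / G.len i j + (G.len i j - 2 * t) / 2
  symm i j hij t := by
    have h := (G.len_pos i j hij).ne'
    rw [G.len_symm j i]
    field_simp
    ring
  vertexCont i j k _ _ := by simp
  deriv_integrable i j _ := Continuous.integrableOn_Icc (by fun_prop)
  deriv_sq_integrable i j _ := Continuous.integrableOn_Icc (by fun_prop)
  ftc i j hij x _ := by
    rw [intervalIntegral.integral_eq_sub_of_hasDerivAt
      (f := fun t => U i + (U j - U i) * (t / G.len i j) + t * (G.len i j - t) / 2)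
      (fun t _ => ?_) (Continuous.intervalIntegrable (by fun_prop) _ _)]
    · ring
    · refine ((((hasDerivAt_id' t).div_const _).const_mul _).const_add (U i) |>.add
        (((hasDerivAt_id' t).mul ((hasDerivAt_id' t).const_sub _)).div_const 2)).congr_deriv ?_
      ring

theorem H1Fun.zeroOn_torsionInterp {G : MetricGraph} {U : Fin G.N → ℝ} {V : Set (Fin G.N)}
    (hU : ∀ i ∈ V, U i = 0) : (H1Fun.torsionInterp G U).ZeroOn V := by
  intro i hi j _
  simp [H1Fun.torsionInterp, hU i hi]

theorem integral_torsionInterp_deriv_sq {L : ℝ} (hL : L ≠ 0) (p q : ℝ) :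
    ∫ t in (0 : ℝ)..L, ((q - p) / L + (L - 2 * t) / 2) ^ 2 = (q - p) ^ 2 / L + L ^ 3 / 12 := by
  rw [intervalIntegral.integral_eq_sub_of_hasDerivAt
    (f := fun t => -((q - p) / L + (L - 2 * t) / 2) ^ 3 / 3)
    (fun t _ => ?_) (Continuous.intervalIntegrable (by fun_prop) _ _)]
  · field_simp
    ring
  · refine ((((((hasDerivAt_id' t).const_mul 2).const_sub L).div_const 2).const_add
      ((q - p) / L)).pow 3 |>.neg.div_const 3).congr_deriv ?_
    push_cast
    ring

theorem integral_torsionInterp {L : ℝ} (hL : L ≠ 0) (p q : ℝ) :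
    ∫ t in (0 : ℝ)..L, (p + (q - p) * (t / L) + t * (L - t) / 2)
      = (p + q) * L / 2 + L ^ 3 / 12 := by
  rw [intervalIntegral.integral_eq_sub_of_hasDerivAt
    (f := fun t => p * t + (q - p) * (t ^ 2 / (2 * L)) + (L * t ^ 2 / 4 - t ^ 3 / 6))
    (fun t _ => ?_) (Continuous.intervalIntegrable (by fun_prop) _ _)]
  · field_simp
    ring
  · refine (((hasDerivAt_id' t).const_mul p).add
      ((((hasDerivAt_id' t).pow 2).div_const (2 * L)).const_mul (q - p)) |>.add
      (((((hasDerivAt_id' t).pow 2).const_mul L).div_const 4).sub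
        (((hasDerivAt_id' t).pow 3).div_const 6))).congr_deriv ?_
    push_cast
    field_simp
    ring

open scoped Classical in
theorem energyJ_torsionInterp (G : MetricGraph) (U : Fin G.N → ℝ) :
    energyJ G (H1Fun.torsionInterp G U) = ∑ i, ∑ j, if i < j ∧ G.edge i j then
      (U j - U i) ^ 2 / (2 * G.len i j) - (U i + U j) * G.len i j / 2 - G.len i j ^ 3 / 24
      else 0 := by
  refine Finset.sum_congr rfl fun i _ => Finset.sum_congr rfl fun j _ => ?_
  split_ifs with h
  · have hL := (G.len_pos i j h.2).ne'
    simp only [H1Fun.torsionInterp]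
    rw [integral_torsionInterp_deriv_sq hL, integral_torsionInterp hL]
    field_simp
    ring
  · rfl

end TorsionInterp

section LowerBound

/-- The flux through the long leg towards the junction in the optimal tripod with legs of
lengths `1`, `1` and `n`. -/
noncomputable def optFlux (n : ℝ) : ℝ := (n ^ 2 - 1) / (2 * n + 1)

/-- The energy of the tripod with legs of lengths `1`, `1` and `n`. -/
noncomputable def optEnergy (n : ℝ) : ℝ :=
  -((n - optFlux n) ^ 3 + optFlux n ^ 3 + 2 * ((optFlux n / 2 + 1) ^ 3 - (optFlux n / 2) ^ 3)) / 6

/-- Every tripod with short leg `c < 1` admits fluxes whose cost beats that of the optimal one. -/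
theorem exists_fluxes {n : ℝ} (hn : 20 ≤ n) {a b c t : ℝ} (hc : 0 ≤ c) (ht : 0 ≤ t)
    (hsum : a + b + c + t = n + 2) (hab : n + 1 ≤ a + b) (hac : 2 ≤ a + c) (hbc : n - 1 ≤ b + c)
    (hc1 : c < 1) :
    ∃ A C : ℝ, t ≤ A ∧ t ≤ C ∧ A + C ≤ b + t ∧
      optEnergy n < -((A + C) ^ 3 + (b + t - A - C) ^ 3 + ((A + a) ^ 3 - A ^ 3)
        + ((C + c) ^ 3 - C ^ 3) + t ^ 3) / 6 := by
  have hβ8 : 8 ≤ optFlux n := by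
    rw [optFlux, le_div_iff₀ (by linarith)]
    nlinarith
  have hβn : optFlux n ≤ n := by
    rw [optFlux, div_le_iff₀ (by linarith)]
    nlinarith
  rw [optEnergy]
  generalize optFlux n = β at *
  set s : ℝ := 1 - c with hs
  set r : ℝ := a + c - 2 with hr
  have hcs : c = 1 - s := by ring
  have har : a = 1 + s + r := by linarith
  have hs0 : 0 < s := by linarith
  have hs1 : s ≤ 1 := by linarith
  have hr0 : 0 ≤ r := by linarith
  have hr2 : r ≤ 2 := by linarith
  have hts : t ≤ s := by linarith
  refine ⟨β / 2 - s - r, β / 2 + s, by linarith, by linarith, by linarith, ?_⟩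
  have e1 : β / 2 - s - r + (β / 2 + s) = β - r := by ring
  have e2 : b + t - (β / 2 - s - r) - (β / 2 + s) = n - β := by linarith
  have e3 : β / 2 - s - r + a = β / 2 + 1 := by linarith
  have e4 : β / 2 + s + c = β / 2 + 1 := by linarith
  rw [e1, e2, e3, e4]
  have ht3 : t ^ 3 ≤ s ^ 2 := by
    calc t ^ 3 ≤ s ^ 3 := pow_le_pow_left₀ ht hts 3
      _ ≤ s ^ 2 := pow_le_pow_of_le_one hs0.le hs1 (by norm_num)
  have hmono : (β - r) ^ 3 + (β / 2 - s) ^ 3 ≤ β ^ 3 + (β / 2 - s - r) ^ 3 := by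
    have h0 : 0 ≤ 3 * r * (β / 2 + s) * (β - r + (β / 2 - s)) :=
      mul_nonneg (by positivity) (by linarith)
    nlinarith
  have hs2 : s ^ 2 < 3 * β * s ^ 2 := by
    have : 0 < s ^ 2 := by positivity
    nlinarith
  nlinarith

theorem dist_ge_abs_sub (p q : EuclideanSpace ℝ (Fin 2)) (k : Fin 2) : |p k - q k| ≤ dist p q := by
  rw [dist_eq_norm, ← Real.norm_eq_abs]
  exact PiLp.norm_apply_le (p - q) k

theorem pt_apply_zero (a b : ℝ) : pt a b 0 = a := rfl

theorem pt_apply_one (a b : ℝ) : pt a b 1 = b := rfl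

/-- The energy of every admissible embedded graph strictly exceeds that of the optimal tripod. -/
theorem exists_lt_energyJ {n : ℕ} (hn : 20 ≤ n) {G : MetricGraph} {V : Set (Fin G.N)}
    {γ : Immersion G 2} (hG : G.Connected) (hl : G.totalLength = (n : ℝ) + 2)
    (hγ : γ.IsEmbedding) (hV : γ.vpos '' V = ({pt (-1) 0, pt 1 0, pt (n : ℝ) 0} :
      Set (EuclideanSpace ℝ (Fin 2)))) :
    ∃ e, optEnergy n < e ∧ ∀ u : H1Fun G, u.ZeroOn V → e ≤ energyJ G u := by
  classical
  have hn' : (20 : ℝ) ≤ n := by exact_mod_cast hn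
  have hH := hG.toSimpleGraph
  obtain ⟨v₁, hv₁, hp₁⟩ : pt (-1) 0 ∈ γ.vpos '' V := by rw [hV]; simp
  obtain ⟨v₂, hv₂, hp₂⟩ : pt 1 0 ∈ γ.vpos '' V := by rw [hV]; simp
  obtain ⟨v₃, hv₃, hp₃⟩ : pt n 0 ∈ γ.vpos '' V := by rw [hV]; simp
  obtain ⟨J, pa, pb, pc, ha, hb, hc, dab, dac, dbc⟩ := hH.exists_tripod v₁ v₂ v₃
  set a := (pa.edges.map G.edgeLen).sum with hla
  set b := (pb.edges.map G.edgeLen).sum with hlb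
  set c := (pc.edges.map G.edgeLen).sum with hlc
  obtain ⟨t, ht⟩ : ∃ t, G.totalLength = a + b + c + t := ⟨G.totalLength - a - b - c, by ring⟩
  have hmain : ∀ (W : Sym2 (Fin G.N) → ℝ) (U : Fin G.N → ℝ), (∀ i ∈ V, U i = 0) →
      (∀ i j, G.toSimpleGraph.Adj i j → ∀ s : ℝ, -s * U i - (G.edgeLen s(i, j) - s) * U j -
        (s ^ 3 + (G.edgeLen s(i, j) - s) ^ 3) / 6 ≤ W s(i, j)) → _ := fun W U hU hE =>
    tripod_energy_lower_bound G.edgeLen_pos hE hH (hU v₁ hv₁) (hU v₂ hv₂) (hU v₃ hv₃) ha hb hc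
      dab dac dbc hla hlb hlc (G.totalLength_eq ▸ ht)
  have hD : ∀ {x y : Fin G.N} (p : G.toSimpleGraph.Walk J x) (q : G.toSimpleGraph.Walk J y),
      dist (γ.vpos x) (γ.vpos y) ≤
        (p.edges.map G.edgeLen).sum + (q.edges.map G.edgeLen).sum := by
    intro x y p q
    have h := γ.dist_vpos_le (p.reverse.append q)
    simpa using h
  have hab : (n : ℝ) + 1 ≤ a + b := by
    have h1 := hD pa pb
    have h2 := dist_ge_abs_sub (γ.vpos v₁) (γ.vpos v₃) 0
    rw [hp₁, hp₃, pt_apply_zero, pt_apply_zero, abs_sub_comm, abs_of_nonneg (by linarith)] at h2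
    rw [hp₁, hp₃] at h1
    linarith
  have hac : 2 ≤ a + c := by
    have h1 := hD pa pc
    have h2 := dist_ge_abs_sub (γ.vpos v₁) (γ.vpos v₂) 0
    rw [hp₁, hp₂, pt_apply_zero, pt_apply_zero, abs_sub_comm, abs_of_nonneg (by linarith)] at h2
    rw [hp₁, hp₂] at h1
    linarith
  have hbc : (n : ℝ) - 1 ≤ b + c := by
    have h1 := hD pb pc
    have h2 := dist_ge_abs_sub (γ.vpos v₃) (γ.vpos v₂) 0
    rw [hp₃, hp₂, pt_apply_zero, pt_apply_zero, abs_of_nonneg (by linarith)] at h2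
    rw [hp₃, hp₂] at h1
    linarith
  have hge : ∀ {x : Fin G.N} (p : G.toSimpleGraph.Walk J x), 0 ≤ (p.edges.map G.edgeLen).sum :=
    fun p => dist_nonneg.trans (γ.dist_vpos_le p)
  have hc0 := hge pc
  rw [← hlc] at hc0
  have ht0 : 0 ≤ t := by
    obtain ⟨W, U, hU, -, hE⟩ := energyJ_eq_sum_edges (G := G) (V := V)
      (H1Fun.torsionInterp G 0) (H1Fun.zeroOn_torsionInterp fun _ _ => rfl)
    exact (hmain W U hU hE).2.2.2.1
  have hc1 : c < 1 := by
    by_cases hJ : J = v₂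
    · subst hJ
      rw [hlc, (SimpleGraph.Walk.isPath_iff_nil.1 hc).eq_nil]
      simp
    · have hmem : v₂ ∈ pc.support.tail := by
        have h := pc.end_mem_support
        rw [← SimpleGraph.Walk.cons_tail_support, List.mem_cons] at h
        exact h.resolve_left fun h => hJ h.symm
      have hnot : v₂ ∉ (pa.reverse.append pb).support := by
        rw [SimpleGraph.Walk.mem_support_append_iff, SimpleGraph.Walk.support_reverse,
          List.mem_reverse, ← SimpleGraph.Walk.cons_tail_support pa,
          ← SimpleGraph.Walk.cons_tail_support pb, List.mem_cons, List.mem_cons]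
        rintro ((h | h) | (h | h))
        · exact hJ h.symm
        · exact dac h hmem
        · exact hJ h.symm
        · exact dbc h hmem
      obtain ⟨q, hq, hqv, hqd⟩ := hγ.exists_crossing hH 0 1 (pa.reverse.append pb) hnot
        (by rw [hp₁, pt_apply_zero]; norm_num) (by rw [hp₃, pt_apply_zero]; linarith)
      have hlen : ((pa.reverse.append pb).edges.map G.edgeLen).sum = a + b := by
        simp [hla, hlb]
      rw [hlen, hp₁, hp₃] at hqd
      have hq1 : q 1 ≠ 0 := by
        intro h
        apply hqv
        rw [hp₂]
        ext k
        fin_cases k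
        · exact hq
        · exact h
      have h1 := dist_ge_abs_sub q (pt n 0) 0
      rw [hq, pt_apply_zero, abs_sub_comm, abs_of_nonneg (by linarith)] at h1
      have h2 : 2 < dist (pt (-1) 0) q := by
        rw [EuclideanSpace.dist_eq]
        apply Real.lt_sqrt_of_sq_lt
        rw [Fin.sum_univ_two, Real.dist_eq, Real.dist_eq, hq, pt_apply_zero, pt_apply_one, sq_abs,
          sq_abs]
        have : 0 < q 1 ^ 2 := by positivity
        linarith
      linarith
  obtain ⟨A, C, hA, hC, hAC, hlt⟩ := exists_fluxes hn' hc0 ht0 (ht.symm.trans hl) hab hac hbc hc1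
  refine ⟨_, hlt, fun u hu => ?_⟩
  obtain ⟨W, U, hU, hW, hE⟩ := energyJ_eq_sum_edges u hu
  rw [hW]
  exact (hmain W U hU hE).2.2.2.2 A C hA hC hAC

end LowerBound

section Star

/-- The star with centre `P 0` and straight legs to the points `P k`, `k ≠ 0`. -/
noncomputable def MetricGraph.star {k : ℕ} {P : Fin (k + 1) → EuclideanSpace ℝ (Fin 2)}
    (hP : Function.Injective P) : MetricGraph where
  N := k + 1
  edge i j := (i = 0 ∧ j ≠ 0) ∨ (j = 0 ∧ i ≠ 0)
  edge_symm i j h := h.symm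
  edge_irrefl i h := by tauto
  len i j := dist (P i) (P j)
  len_symm i j := dist_comm _ _
  len_pos i j h := dist_pos.2 fun he => by
    have := hP he
    subst this
    tauto

theorem MetricGraph.star_connected {k : ℕ} {P : Fin (k + 1) → EuclideanSpace ℝ (Fin 2)}
    (hP : Function.Injective P) : (MetricGraph.star hP).Connected := by
  have h0 : ∀ i : Fin (k + 1),
      Relation.ReflTransGen (MetricGraph.star hP).edge (0 : Fin (k + 1)) i ∧
      Relation.ReflTransGen (MetricGraph.star hP).edge i (0 : Fin (k + 1)) := by
    intro i
    by_cases hi : i = 0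
    · subst hi
      exact ⟨.refl, .refl⟩
    · exact ⟨.single (Or.inl ⟨rfl, hi⟩), .single (Or.inr ⟨rfl, hi⟩)⟩
  exact ⟨k.succ_pos, fun i j => (h0 i).2.trans (h0 j).1⟩

open scoped Classical in
theorem MetricGraph.sum_star {k : ℕ} {P : Fin (k + 1) → EuclideanSpace ℝ (Fin 2)}
    (hP : Function.Injective P) (f : Fin (k + 1) → Fin (k + 1) → ℝ) :
    (∑ i : Fin (k + 1), ∑ j : Fin (k + 1),
      if i < j ∧ (MetricGraph.star hP).edge i j then f i j else 0) = ∑ i : Fin k, f 0 i.succ := by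
  rw [Fin.sum_univ_succ, Fin.sum_univ_succ]
  have hz : ∀ (i : Fin k) (j : Fin (k + 1)),
      ¬(i.succ < j ∧ (MetricGraph.star hP).edge i.succ j) := by
    rintro i j ⟨hij, ⟨h, -⟩ | ⟨rfl, -⟩⟩
    · exact Fin.succ_ne_zero i h
    · exact Fin.not_lt_zero _ hij
  simp only [hz, if_false, Finset.sum_const_zero, add_zero]
  simp [MetricGraph.star]

/-- The straight-line drawing of a star. -/
noncomputable def Immersion.star {k : ℕ} {P : Fin (k + 1) → EuclideanSpace ℝ (Fin 2)}
    (hP : Function.Injective P) : Immersion (MetricGraph.star hP) 2 where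
  toFun i j x := AffineMap.lineMap (P i) (P j) (x / dist (P i) (P j))
  vpos := P
  start i j _ := by simp
  symm i j hij x := by
    have h : dist (P i) (P j) ≠ 0 := ((MetricGraph.star hP).len_pos i j hij).ne'
    rw [← AffineMap.lineMap_apply_one_sub (P i), dist_comm (P j)]
    congr 1
    simp only [MetricGraph.star]
    field_simp
  arclen i j hij s t _ hst _ := by
    have h : dist (P i) (P j) ≠ 0 := ((MetricGraph.star hP).len_pos i j hij).ne'
    have hiso : Isometry fun x : ℝ =>
        (AffineMap.lineMap (P i) (P j) (x / dist (P i) (P j)) : EuclideanSpace ℝ (Fin 2)) := by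
      refine Isometry.of_dist_eq fun x y => ?_
      rw [dist_lineMap_lineMap, Real.dist_eq, Real.dist_eq, ← sub_div, abs_div,
        abs_of_nonneg dist_nonneg, div_mul_cancel₀ _ h]
    have hvar := (monotone_id.monotoneOn (Icc s t)).eVariationOn_eq (left_mem_Icc.2 hst)
      (right_mem_Icc.2 hst)
    rw [inter_self] at hvar
    refine Eq.trans ?_ hvar
    simp only [eVariationOn, hiso.edist_eq, id]
  inj i j hij x _ y _ hxy := by
    have h : dist (P i) (P j) ≠ 0 := ((MetricGraph.star hP).len_pos i j hij).ne'
    have := AffineMap.lineMap_injective ℝ (dist_ne_zero.1 h) hxy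
    exact (div_left_inj' h).1 this

/-- A straight-line star with collinear leaves is embedded as soon as its centre is off the line. -/
theorem Immersion.isEmbedding_star {k : ℕ} {P : Fin (k + 1) → EuclideanSpace ℝ (Fin 2)}
    (hP : Function.Injective P) (h0 : P 0 1 ≠ 0) (h1 : ∀ i, i ≠ 0 → P i 1 = 0) :
    (Immersion.star hP).IsEmbedding := by
  have key : ∀ i j : Fin (k + 1), i ≠ 0 → j ≠ 0 → ∀ s t : ℝ, s ≠ 0 →
      (AffineMap.lineMap (P 0) (P i) s : EuclideanSpace ℝ (Fin 2)) =
        AffineMap.lineMap (P 0) (P j) t → i = j := by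
    intro i j hi hj s t hs h
    have e0 := congrArg (fun v : EuclideanSpace ℝ (Fin 2) => v 0) h
    have e1 := congrArg (fun v : EuclideanSpace ℝ (Fin 2) => v 1) h
    simp only [AffineMap.lineMap_apply, vsub_eq_sub, vadd_eq_add, PiLp.add_apply,
      PiLp.smul_apply, PiLp.sub_apply, smul_eq_mul, h1 i hi, h1 j hj] at e0 e1
    have hst : s = t := by
      have : (s - t) * P 0 1 = 0 := by linarith
      exact sub_eq_zero.1 ((mul_eq_zero.1 this).resolve_right h0)
    subst hst
    have e : P i 0 = P j 0 := by
      have : s * (P i 0 - P j 0) = 0 := by linarith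
      exact sub_eq_zero.1 ((mul_eq_zero.1 this).resolve_left hs)
    apply hP
    ext m
    fin_cases m
    · exact e
    · exact (h1 i hi).trans (h1 j hj).symm
  have hedge : ∀ i j : Fin (k + 1), (MetricGraph.star hP).edge i j → ∀ x : ℝ,
      ∃ m : Fin (k + 1), m ≠ 0 ∧ ((i = 0 ∧ j = m) ∨ (i = m ∧ j = 0)) ∧ ∃ s : ℝ,
        (Immersion.star hP).toFun i j x = AffineMap.lineMap (P 0) (P m) s ∧
        (x ∈ Ioo 0 ((MetricGraph.star hP).len i j) → s ≠ 0) := by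
    intro i j hij x
    have hL := (MetricGraph.star hP).len_pos i j hij
    rcases id hij with ⟨rfl, hj⟩ | ⟨rfl, hi⟩
    · exact ⟨j, hj, Or.inl ⟨rfl, rfl⟩, _, rfl, fun hx => (div_pos hx.1 hL).ne'⟩
    · refine ⟨i, hi, Or.inr ⟨rfl, rfl⟩, 1 - x / dist (P i) (P 0), ?_, fun hx => ?_⟩
      · rw [AffineMap.lineMap_apply_one_sub]
        rfl
      · exact (sub_pos.2 ((div_lt_one hL).2 hx.2)).ne'
  refine ⟨fun i j i' j' hij hij' hne x hx y _ heq => hne ?_, hP⟩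
  obtain ⟨m, hm, hmij, s, hs, hs0⟩ := hedge i j hij x
  obtain ⟨m', hm', hmij', s', hs', -⟩ := hedge i' j' hij' y
  have hmm := key m m' hm hm' s s' (hs0 hx) (hs.symm.trans (heq.trans hs'))
  subst hmm
  rcases hmij with ⟨rfl, rfl⟩ | ⟨rfl, rfl⟩ <;> rcases hmij' with ⟨rfl, rfl⟩ | ⟨rfl, rfl⟩ <;>
    first | exact Or.inl ⟨rfl, rfl⟩ | exact Or.inr ⟨rfl, rfl⟩

theorem energyJ_star_torsionInterp {k : ℕ} {P : Fin (k + 1) → EuclideanSpace ℝ (Fin 2)}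
    (hP : Function.Injective P) (m : ℝ) :
    energyJ (MetricGraph.star hP) (H1Fun.torsionInterp _ (Fin.cons m 0 : Fin (k + 1) → ℝ)) =
      ∑ i : Fin k, (m ^ 2 / (2 * dist (P 0) (P i.succ)) - m * dist (P 0) (P i.succ) / 2
        - dist (P 0) (P i.succ) ^ 3 / 24) := by
  refine (energyJ_torsionInterp _ _).trans <| (MetricGraph.sum_star hP fun i j =>
    ((Fin.cons m 0 : Fin (k + 1) → ℝ) j - (Fin.cons m 0 : Fin (k + 1) → ℝ) i) ^ 2 /
      (2 * dist (P i) (P j)) - ((Fin.cons m 0 : Fin (k + 1) → ℝ) i +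
        (Fin.cons m 0 : Fin (k + 1) → ℝ) j) * dist (P i) (P j) / 2 -
      dist (P i) (P j) ^ 3 / 24).trans (Finset.sum_congr rfl fun i _ => ?_)
  simp

end Star

section UpperBound

theorem dist_pt_zero (x y d : ℝ) : dist (pt x y) (pt d 0) = √((d - x) ^ 2 + y ^ 2) := by
  rw [EuclideanSpace.dist_eq, Fin.sum_univ_two, Real.dist_eq, Real.dist_eq, sq_abs, sq_abs,
    pt_apply_zero, pt_apply_zero, pt_apply_one, pt_apply_one]
  congr 1
  ring

/-- Off the axis, but arbitrarily close to `(0, 0)`, there is a point whose star through `(-1, 0)`,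
`(1, 0)` and `(n, 0)` has total length `n + 2`. -/
theorem exists_star_centre {n ε : ℝ} (hn : 2 ≤ n) (hε : 0 < ε) (hε' : ε ≤ 1 / 4) :
    ∃ x ∈ Icc 0 ε, √((-1 - x) ^ 2 + ε ^ 2) + √((1 - x) ^ 2 + ε ^ 2) + √((n - x) ^ 2 + ε ^ 2)
      = n + 2 := by
  have hsqrt : ∀ d a : ℝ, 1 / 2 ≤ a → d ^ 2 = a ^ 2 → √(d ^ 2 + ε ^ 2) ≤ a + ε ^ 2 := by
    intro d a ha hd
    rw [Real.sqrt_le_left (by positivity), hd]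
    nlinarith [sq_nonneg ε]
  have hsqrt' : ∀ d a : ℝ, 0 ≤ a → d ^ 2 = a ^ 2 → a ≤ √(d ^ 2 + ε ^ 2) := by
    intro d a ha hd
    apply Real.le_sqrt_of_sq_le
    nlinarith [sq_nonneg ε]
  refine intermediate_value_Icc' (f := fun x => √((-1 - x) ^ 2 + ε ^ 2) +
    √((1 - x) ^ 2 + ε ^ 2) + √((n - x) ^ 2 + ε ^ 2)) hε.le (by fun_prop) ⟨?_, ?_⟩
  · have h1 := hsqrt (-1 - ε) (1 + ε) (by linarith) (by ring)
    have h2 := hsqrt (1 - ε) (1 - ε) (by linarith) (by ring)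
    have h3 := hsqrt (n - ε) (n - ε) (by linarith) (by ring)
    nlinarith
  · have h1 := hsqrt' (-1 - 0) 1 (by linarith) (by ring)
    have h2 := hsqrt' (1 - 0) 1 (by linarith) (by ring)
    have h3 := hsqrt' (n - 0) n (by linarith) (by ring)
    linarith

/-- Embedded stars have energy arbitrarily close to that of the optimal tripod. -/
theorem exists_star_energyJ_lt {n : ℕ} (hn : 2 ≤ n) {e : ℝ} (he : optEnergy n < e) :
    ∃ (G : MetricGraph) (V : Set (Fin G.N)) (γ : Immersion G 2),
      G.Connected ∧ G.totalLength = (n : ℝ) + 2 ∧ γ.IsEmbedding ∧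
      γ.vpos '' V = ({pt (-1) 0, pt 1 0, pt (n : ℝ) 0} : Set (EuclideanSpace ℝ (Fin 2))) ∧
      ∃ u : H1Fun G, u.ZeroOn V ∧ energyJ G u < e := by
  have hn' : (2 : ℝ) ≤ n := by exact_mod_cast hn
  obtain ⟨m, hm⟩ : ∃ m : ℝ, m = n * (n + 2) / (2 * (2 * n + 1)) := ⟨_, rfl⟩
  let leg : ℝ → ℝ := fun L => m ^ 2 / (2 * L) - m * L / 2 - L ^ 3 / 24
  let F : ℝ × ℝ → ℝ := fun p => leg √((-1 - p.1) ^ 2 + p.2 ^ 2) +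
    leg √((1 - p.1) ^ 2 + p.2 ^ 2) + leg √((n - p.1) ^ 2 + p.2 ^ 2)
  have hF0 : F (0, 0) = optEnergy n := by
    have h1 : √((-1 - (0 : ℝ)) ^ 2 + 0 ^ 2) = 1 := by norm_num
    have h2 : √((1 - (0 : ℝ)) ^ 2 + 0 ^ 2) = 1 := by norm_num
    have h3 : √((n - (0 : ℝ)) ^ 2 + 0 ^ 2) = n := by
      rw [sub_zero, zero_pow two_ne_zero, add_zero, Real.sqrt_sq (by linarith)]
    simp only [F, leg]
    rw [h1, h2, h3, optEnergy, optFlux, hm]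
    have : (2 * (n : ℝ) + 1) ≠ 0 := by positivity
    have : (n : ℝ) ≠ 0 := by positivity
    field_simp
    ring
  have hleg : ∀ d : ℝ, d ≠ 0 →
      ContinuousAt (fun p : ℝ × ℝ => leg √((d - p.1) ^ 2 + p.2 ^ 2)) (0, 0) := by
    intro d hd
    have h0 : 2 * √((d - (0 : ℝ)) ^ 2 + 0 ^ 2) ≠ 0 := by
      have : 0 < (d - (0 : ℝ)) ^ 2 + 0 ^ 2 := by
        rw [sub_zero]
        positivity
      positivity
    have hc : ContinuousAt (fun p : ℝ × ℝ => √((d - p.1) ^ 2 + p.2 ^ 2)) (0, 0) := by fun_prop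
    exact ((continuousAt_const.div (continuousAt_const.mul hc) h0).sub
      ((continuousAt_const.mul hc).div_const 2)).sub ((hc.pow 3).div_const 24)
  have hF : ContinuousAt F (0, 0) :=
    ((hleg (-1) (by norm_num)).add (hleg 1 one_ne_zero)).add (hleg n (by positivity))
  rw [← hF0] at he
  obtain ⟨η, hη, hball⟩ := Metric.eventually_nhds_iff.1 (hF.eventually (gt_mem_nhds he))
  obtain ⟨x, hx, hlen⟩ := exists_star_centre hn'
    (lt_min (by norm_num : (0 : ℝ) < 1 / 4) (half_pos hη))
    (min_le_left _ _)
  have hε : 0 < min (1 / 4) (η / 2) := lt_min (by norm_num) (half_pos hη)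
  have hεη : min (1 / 4) (η / 2) < η := (min_le_right _ _).trans_lt (half_lt_self hη)
  generalize min (1 / 4) (η / 2) = ε at *
  have hlt : F (x, ε) < e := by
    apply hball
    rw [Prod.dist_eq, Real.dist_eq, Real.dist_eq, max_lt_iff, sub_zero, sub_zero,
      abs_of_nonneg hx.1, abs_of_pos hε]
    exact ⟨hx.2.trans_lt hεη, hεη⟩
  let P : Fin (3 + 1) → EuclideanSpace ℝ (Fin 2) := ![pt x ε, pt (-1) 0, pt 1 0, pt n 0]
  have hP : Function.Injective P := by
    have h : ∀ i j : Fin 4, i < j → P i ≠ P j := by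
      intro i j hij h
      have e0 := congrArg (fun v : EuclideanSpace ℝ (Fin 2) => v 0) h
      have e1 := congrArg (fun v : EuclideanSpace ℝ (Fin 2) => v 1) h
      fin_cases i <;> fin_cases j <;> simp [P, pt] at hij e0 e1 <;> linarith
    intro i j h'
    rcases lt_trichotomy i j with hij | hij | hij
    · exact absurd h' (h i j hij)
    · exact hij
    · exact absurd h'.symm (h j i hij)
  refine ⟨MetricGraph.star hP, {i : Fin (3 + 1) | i ≠ 0}, Immersion.star hP,
    MetricGraph.star_connected hP, ?_, Immersion.isEmbedding_star hP hε.ne' ?_, ?_,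
    H1Fun.torsionInterp _ (Fin.cons m 0 : Fin (3 + 1) → ℝ), H1Fun.zeroOn_torsionInterp ?_, ?_⟩
  · refine (MetricGraph.sum_star hP fun i j => dist (P i) (P j)).trans ?_
    rw [← hlen, ← dist_pt_zero, ← dist_pt_zero, ← dist_pt_zero, Fin.sum_univ_three]
    rfl
  · intro i hi
    fin_cases i
    · exact absurd rfl hi
    all_goals rfl
  · change P '' {i | i ≠ 0} = _
    ext p
    simp [P, Fin.exists_fin_succ, eq_comm]
  · intro i hi
    obtain ⟨j, rfl⟩ := Fin.exists_succ_eq.2 hi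
    rfl
  · rw [energyJ_star_torsionInterp]
    refine lt_of_eq_of_lt ?_ hlt
    simp only [F, leg, ← dist_pt_zero, Fin.sum_univ_three]
    rfl

end UpperBound

/-- Nonexistence of optimal embedded graphs: for
`D₁ = (-1, 0)`, `D₂ = (1, 0)`, `D₃ = (n, 0)` and `l = n + 2`, for all sufficiently large
positive integers `n` the infimum of the energy over connected embedded metric graphs of
total length `l` whose marked vertices are sent onto `{D₁, D₂, D₃}` is not attained. -/
theorem no_optimal_embedded_graph :
    ∃ n₀ : ℕ, ∀ n : ℕ, n₀ ≤ n →
      ¬ ∃ (G : MetricGraph) (V : Set (Fin G.N)) (γ : Immersion G 2),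
          (G.Connected ∧ G.totalLength = (n : ℝ) + 2 ∧ γ.IsEmbedding ∧
            γ.vpos '' V = ({pt (-1) 0, pt 1 0, pt (n : ℝ) 0} :
              Set (EuclideanSpace ℝ (Fin 2)))) ∧
          dirEnergy G V =
            sInf {e : ℝ | ∃ (G' : MetricGraph) (V' : Set (Fin G'.N)) (γ' : Immersion G' 2),
              G'.Connected ∧ G'.totalLength = (n : ℝ) + 2 ∧ γ'.IsEmbedding ∧
              γ'.vpos '' V' = ({pt (-1) 0, pt 1 0, pt (n : ℝ) 0} :
                Set (EuclideanSpace ℝ (Fin 2))) ∧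
              dirEnergy G' V' = e} := by
  refine ⟨20, fun n hn => ?_⟩
  rintro ⟨G, V, γ, ⟨hG, hl, hγ, hV⟩, hmin⟩
  have hlow : ∀ {G : MetricGraph} {V : Set (Fin G.N)} {γ : Immersion G 2}, G.Connected →
      G.totalLength = (n : ℝ) + 2 → γ.IsEmbedding →
      γ.vpos '' V = ({pt (-1) 0, pt 1 0, pt (n : ℝ) 0} : Set (EuclideanSpace ℝ (Fin 2))) →
      optEnergy n < dirEnergy G V ∧
        BddBelow {e : ℝ | ∃ u : H1Fun G, u.ZeroOn V ∧ energyJ G u = e} := by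
    intro G V γ hG hl hγ hV
    obtain ⟨e, he, hle⟩ := exists_lt_energyJ hn hG hl hγ hV
    refine ⟨he.trans_le (le_csInf ?_ ?_), e, ?_⟩
    · exact ⟨_, H1Fun.torsionInterp G 0, H1Fun.zeroOn_torsionInterp fun _ _ => rfl, rfl⟩
    · rintro _ ⟨u, hu, rfl⟩
      exact hle u hu
    · rintro _ ⟨u, hu, rfl⟩
      exact hle u hu
  have hlt := (hlow hG hl hγ hV).1
  obtain ⟨G', V', γ', hG', hl', hγ', hV', u, hu, hlt'⟩ :=
    exists_star_energyJ_lt (by omega : 2 ≤ n) hlt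
  refine hlt'.not_ge ?_
  calc dirEnergy G V ≤ dirEnergy G' V' := by
        rw [hmin]
        refine csInf_le ⟨optEnergy n, ?_⟩ ⟨G', V', γ', hG', hl', hγ', hV', rfl⟩
        rintro _ ⟨G, V, γ, hG, hl, hγ, hV, rfl⟩
        exact (hlow hG hl hγ hV).1.le
    _ ≤ energyJ G' u := csInf_le (hlow hG' hl' hγ' hV').2 ⟨u, hu, rfl⟩
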